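/- Let A be a unital Banach *-algebra which is a dense *-subalgebra of a unital C*-algebra B, closed under holomorphic functional calculus in B, and let Θ : A → M_k(ℂ) be a positive linear map (Θ(a*a) positive semidefinite for all a ∈ A). Then Θ extends uniquely to a positive linear map on B. -/

import Mathlib

section aux
open scoped ComplexOrder InnerProductSpace

lemma aux_schwarz (h : ℝ → ℝ) (hc : Continuous h) (α m β : ℝ) (h1 : α < m) (h2 : m < β)
    (hα : h α = 0) (hm : h m = 0)
    (hs : ∀ x, x < β → ∃ C : ℝ, ∀ s, 0 < s → h (x + s) + h (x - s) - 2 * h x ≤ C * s ^ 3) :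
    h β ≤ 0 := by
  by_contra! hb
  set c := h β / (β - α) with hcdef
  have hαβ : 0 < β - α := by linarith
  have hc0 : 0 < c := div_pos hb hαβ
  have hcβ : c * (β - α) = h β := by rw [hcdef]; field_simp
  -- choose ε
  set ε := c / (2 * (β - m)) with hε
  have hβm : 0 < β - m := by linarith
  have hε0 : 0 < ε := by positivity
  have hεm : ε * (β - m) = c / 2 := by rw [hε]; field_simp
  set k : ℝ → ℝ := fun x => h x - c * (x - α) - ε * (x - α) * (x - β) with hk
  have hkc : Continuous k := by fun_prop
  obtain ⟨x0, hx0, hmin⟩ := isCompact_Icc.exists_isMinOn (s := Set.Icc α β)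
    ⟨m, h1.le, h2.le⟩ hkc.continuousOn
  have hkm : k m < 0 := by
    have : k m = - (m - α) * (c / 2) := by
      simp only [hk, hm]; linear_combination (m - α) * hεm
    rw [this]; nlinarith
  have hx0m : k x0 < 0 := lt_of_le_of_lt (hmin ⟨h1.le, h2.le⟩) hkm
  have hx0α : x0 ≠ α := by
    rintro rfl; simp [hk, hα] at hx0m
  have hx0β : x0 ≠ β := by
    rintro rfl; simp [hk, hcβ] at hx0m
  have ha : α < x0 := lt_of_le_of_ne hx0.1 (Ne.symm hx0α)
  have hb' : x0 < β := lt_of_le_of_ne hx0.2 hx0β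
  obtain ⟨C, hC⟩ := hs x0 hb'
  set s := min (min (x0 - α) (β - x0)) (ε / (|C| + 1)) with hsdef
  have hs0 : 0 < s := by
    have : 0 < |C| + 1 := by positivity
    refine lt_min (lt_min (by linarith) (by linarith)) (by positivity)
  have hs1 : s ≤ x0 - α := (min_le_left _ _).trans (min_le_left _ _)
  have hs2 : s ≤ β - x0 := (min_le_left _ _).trans (min_le_right _ _)
  have hs3 : s * (|C| + 1) ≤ ε := by
    rw [← le_div_iff₀ (by positivity)]; exact min_le_right _ _
  have e1 : k x0 ≤ k (x0 + s) := hmin ⟨by linarith, by linarith⟩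
  have e2 : k x0 ≤ k (x0 - s) := hmin ⟨by linarith, by linarith⟩
  have e3 := hC s hs0
  have e4 : k (x0 + s) + k (x0 - s) - 2 * k x0
      = h (x0 + s) + h (x0 - s) - 2 * h x0 - 2 * ε * s ^ 2 := by
    simp only [hk]; ring
  have e5 : C * s ≤ ε := by nlinarith [le_abs_self C]
  have e6 : C * s ^ 3 ≤ ε * s ^ 2 := by
    have := mul_le_mul_of_nonneg_right e5 (sq_nonneg s)
    linarith [this, show C * s ^ 3 = C * s * s ^ 2 by ring]
  have e7 : 0 < ε * s ^ 2 := by positivity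
  linarith

lemma aux_tent (l s x : ℝ) (hs : 0 < s) :
    |(x - l) * (max (l + s - x) 0 + max (l - s - x) 0 - 2 * max (l - x) 0) * (x - l)| ≤ s ^ 3 := by
  set t := max (l + s - x) 0 + max (l - s - x) 0 - 2 * max (l - x) 0 with ht
  have : 0 ≤ t ∧ t ≤ s ∧ (t = 0 ∨ |x - l| ≤ s) := by
    rw [abs_le]
    rcases le_total (l + s - x) 0 with h1 | h1 <;> rcases le_total (l - s - x) 0 with h2 | h2 <;>
    rcases le_total (l - x) 0 with h3 | h3 <;>
    simp only [ht, max_eq_left, max_eq_right, h1, h2, h3] <;>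
    refine ⟨by linarith, by linarith, ?_⟩ <;>
    first
    | (left; linarith)
    | (right; constructor <;> linarith)
  obtain ⟨h0, h1, h2⟩ := this
  rcases h2 with h2 | h2
  · rw [h2]; simp; positivity
  · have e : (x - l) * t * (x - l) = t * |x - l| ^ 2 := by rw [sq_abs]; ring
    rw [e, abs_of_nonneg (by positivity)]
    calc t * |x - l| ^ 2 ≤ s * s ^ 2 := by gcongr
      _ = s ^ 3 := by ring

lemma aux_operator {H : Type*} [NormedAddCommGroup H] [InnerProductSpace ℂ H] [CompleteSpace H]
    (Q : H →L[ℂ] H) (hQ : IsSelfAdjoint Q) (ξ : H)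
    (hξ : ∀ l : ℝ, l < 0 → ∃ η : H, Q η - (l : ℂ) • η = ξ) :
    0 ≤ (⟪ξ, Q ξ⟫_ℂ).re := by
  set T : ℝ → (H →L[ℂ] H) := fun l => cfc (fun x : ℝ => max (l - x) 0) Q with hT
  set h : ℝ → ℝ := fun l => (⟪ξ, T l ξ⟫_ℂ).re with hh
  have bound : ∀ (S : H →L[ℂ] H) (v : H) (c : ℝ), ‖S‖ ≤ c → (⟪v, S v⟫_ℂ).re ≤ c * ‖v‖ ^ 2 := by
    intro S v c hS
    calc (⟪v, S v⟫_ℂ).re ≤ ‖⟪v, S v⟫_ℂ‖ := Complex.re_le_norm _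
      _ ≤ ‖v‖ * ‖S v‖ := norm_inner_le_norm _ _
      _ ≤ ‖v‖ * (c * ‖v‖) := by
        gcongr; exact (S.le_opNorm v).trans (by gcongr)
      _ = _ := by ring
  have hTlip : LipschitzWith 1 T := by
    refine LipschitzWith.of_dist_le_mul fun a b => ?_
    rw [dist_eq_norm, Real.dist_eq, NNReal.coe_one, one_mul]
    simp only [hT]
    rw [← cfc_sub (fun x : ℝ => max (a - x) 0) (fun x : ℝ => max (b - x) 0) Q
      (by fun_prop) (by fun_prop)]
    refine norm_cfc_le (abs_nonneg _) fun x _ => ?_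
    rw [Real.norm_eq_abs]
    have := abs_max_sub_max_le_abs (a - x) (b - x) 0
    simpa using this
  have hcont : Continuous h := by
    have : Continuous T := hTlip.continuous
    simp only [hh]
    fun_prop
  have hzero : ∀ l, l < -‖Q‖ → h l = 0 := by
    intro l hl
    have : T l = 0 := by
      simp only [hT]
      rw [cfc_congr (g := fun _ => (0 : ℝ))]
      · simp
      · intro x hx
        have hx' : ‖x‖ ≤ ‖Q‖ := by
          refine (spectrum.norm_le_norm_mul_of_mem hx).trans ?_
          have : ‖(1 : H →L[ℂ] H)‖ ≤ 1 := ContinuousLinearMap.norm_id_le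
          nlinarith [norm_nonneg Q]
        rw [Real.norm_eq_abs, abs_le] at hx'
        simp only
        exact max_eq_right (by linarith [hx'.1])
    simp [hh, this]
  have h0 : h 0 ≤ 0 := by
    refine aux_schwarz h hcont (-‖Q‖ - 2) (-‖Q‖ - 1) 0 (by linarith)
      (by linarith [norm_nonneg Q]) (hzero _ (by linarith)) (hzero _ (by linarith)) ?_
    intro l hl
    obtain ⟨η, hη⟩ := hξ l hl
    refine ⟨‖η‖ ^ 2, fun s hs => ?_⟩
    set D : H →L[ℂ] H := cfc (fun x : ℝ => x - l) Q with hD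
    have hDη : D η = ξ := by
      rw [hD, cfc_sub (fun x : ℝ => x) (fun _ => l) Q, cfc_id' ℝ Q, cfc_const l Q, ← hη]
      simp [Algebra.algebraMap_eq_smul_one]
    have hDsa : IsSelfAdjoint D := cfc_predicate _ _
    set R := T (l + s) + T (l - s) - 2 • T l with hR
    have hRcfc : R = cfc (fun x : ℝ => max (l + s - x) 0 + max (l - s - x) 0 - 2 • max (l - x) 0) Q := by
      simp only [hR, hT]
      rw [cfc_sub _ _ Q (by fun_prop) (by fun_prop), cfc_add (a := Q) _ _ (by fun_prop) (by fun_prop),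
        cfc_smul 2 (fun x : ℝ => max (l - x) 0) Q (by fun_prop)]
    have hN : ‖D * R * D‖ ≤ s ^ 3 := by
      rw [hRcfc, hD, ← cfc_mul _ _ Q (by fun_prop) (by fun_prop),
        ← cfc_mul _ _ Q (by fun_prop) (by fun_prop)]
      refine norm_cfc_le (by positivity) fun x _ => ?_
      have := aux_tent l s x hs
      simpa [Real.norm_eq_abs] using this
    have e : h (l + s) + h (l - s) - 2 * h l = (⟪η, (D * R * D) η⟫_ℂ).re := by
      have : ⟪η, (D * R * D) η⟫_ℂ = ⟪ξ, R ξ⟫_ℂ := by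
        rw [mul_apply_eq_comp, mul_apply_eq_comp, hDη]
        nth_rewrite 1 [← hDsa.star_eq]
        rw [ContinuousLinearMap.star_eq_adjoint, ContinuousLinearMap.adjoint_inner_right, hDη]
      rw [this]
      simp only [hh, hR]
      simp [two_smul]
      ring
    rw [e]
    refine (bound _ _ _ hN).trans (le_of_eq (by ring))
  have hpos : 0 ≤ Q + T 0 := by
    have : Q + T 0 = cfc (fun x : ℝ => x + max (0 - x) 0) Q := by
      rw [cfc_add (a := Q) _ _ (by fun_prop) (by fun_prop), cfc_id' ℝ Q]
    rw [this]
    refine cfc_nonneg fun x _ => ?_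
    rcases le_total 0 x with hx | hx <;> simp [hx]
  rw [ContinuousLinearMap.nonneg_iff_isPositive] at hpos
  have := hpos.re_inner_nonneg_right ξ
  simp [inner_add_right] at this
  simp only [hh] at h0
  linarith

section gns
variable {A : Type*} [Ring A] [StarRing A] [Algebra ℂ A] [StarModule ℂ A]

lemma aux_herm (φ : A →ₗ[ℂ] ℂ) (hφ : ∀ a, 0 ≤ φ (star a * a)) (a : A) :
    φ (star a) = star (φ a) := by
  have key : ∀ z : ℂ, (z * φ (star a) + star z * φ a).im = 0 := by
    intro z
    have h1 := (Complex.nonneg_iff.1 (hφ (a + algebraMap ℂ A z))).2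
    have h2 := (Complex.nonneg_iff.1 (hφ a)).2
    have h3 := (Complex.nonneg_iff.1 (hφ (algebraMap ℂ A z))).2
    have e : star (a + algebraMap ℂ A z) * (a + algebraMap ℂ A z)
        = star a * a + z • star a + star z • a
          + star (algebraMap ℂ A z) * algebraMap ℂ A z := by
      simp only [Algebra.algebraMap_eq_smul_one, star_add, star_smul, star_one, add_mul, mul_add,
        smul_mul_assoc, mul_smul_comm, one_mul, mul_one, smul_add]
      abel
    rw [e, map_add, map_add, map_add, map_smul, map_smul] at h1
    simp only [Complex.add_im, smul_eq_mul] at h1 ⊢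
    linarith
  have k1 := key 1
  have k2 := key Complex.I
  simp at k1 k2
  apply Complex.ext
  · simp; linarith
  · simp; linarith

lemma aux_gns (φ : A →ₗ[ℂ] ℂ) (hφ : ∀ a, 0 ≤ φ (star a * a)) (q : A) (hq : star q = q)
    (hb : ∀ x : A, (φ (star (q * x) * (q * x))).re ≤ (φ (star x * x)).re)
    (hr : ∀ l : ℝ, l < 0 → ∃ r : A, (q - algebraMap ℂ A l) * r = 1) (y : A) :
    0 ≤ (φ (star y * (q * y))).re := by
  let core : PreInnerProductSpace.Core ℂ A :=
    { inner := fun a b => φ (star a * b)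
      conj_inner_symm := fun a b => by
        have := aux_herm φ hφ (star b * a)
        simp at this
        simpa using this.symm
      re_inner_nonneg := fun a => (Complex.nonneg_iff.1 (hφ a)).1
      add_left := fun a b c => by simp [add_mul]
      smul_left := fun a b c => by simp }
  let : SeminormedAddCommGroup A :=
    InnerProductSpace.Core.toSeminormedAddCommGroup (c := core)
  let : InnerProductSpace ℂ A := InnerProductSpace.ofCore core
  have hin : ∀ a b : A, ⟪a, b⟫_ℂ = φ (star a * b) := fun a b => rfl
  let L : A →L[ℂ] A := (LinearMap.mulLeft ℂ q).mkContinuous 1 (fun x => by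
    rw [one_mul]
    refine Real.sqrt_le_sqrt ?_
    exact hb x)
  have hL : ∀ x, L x = q * x := fun x => rfl
  let Q := L.completion
  have hQc : ∀ x : A, Q (x : UniformSpace.Completion A) = ((q * x : A) : UniformSpace.Completion A) := by
    intro x
    simp [Q, hL]
  have hQ : IsSelfAdjoint Q := by
    rw [ContinuousLinearMap.isSelfAdjoint_iff_isSymmetric]
    intro u v
    induction u, v using UniformSpace.Completion.induction_on₂ with
    | hp =>
      refine isClosed_eq ?_ ?_
      · simp only [ContinuousLinearMap.coe_coe]; fun_prop
      · simp only [ContinuousLinearMap.coe_coe]; fun_prop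
    | ih a b =>
      simp only [ContinuousLinearMap.coe_coe]
      rw [hQc, hQc, UniformSpace.Completion.inner_coe, UniformSpace.Completion.inner_coe, hin, hin]
      simp [hq, mul_assoc]
  have := aux_operator Q hQ (y : UniformSpace.Completion A) (fun l hl => by
    obtain ⟨r, hr⟩ := hr l hl
    refine ⟨((r * y : A) : UniformSpace.Completion A), ?_⟩
    rw [hQc, ← UniformSpace.Completion.coe_smul, ← UniformSpace.Completion.coe_sub]
    congr 1
    have : (q - algebraMap ℂ A l) * r * y = y := by rw [hr, one_mul]
    rw [sub_mul, sub_mul, Algebra.algebraMap_eq_smul_one, smul_mul_assoc, one_mul, smul_mul_assoc,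
      mul_assoc] at this
    exact this)
  rw [hQc, UniformSpace.Completion.inner_coe, hin] at this
  exact this

/-- If `p` is self-adjoint and all `p² + c p + 1`, `c ≥ 0`, are invertible, then `φ p ≥ 0`. -/
lemma aux_pos (φ : A →ₗ[ℂ] ℂ) (hφ : ∀ a, 0 ≤ φ (star a * a)) (p : A) (hp : star p = p)
    (hu : ∀ c : ℝ, 0 ≤ c → IsUnit (p * p + algebraMap ℂ A c * p + 1)) :
    0 ≤ (φ p).re := by
  obtain ⟨u, hu0⟩ := hu 0 le_rfl
  simp at hu0
  set d : A := ↑u⁻¹ with hd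
  have hd1 : d * (p * p + 1) = 1 := by rw [← hu0, hd]; simp
  have hd2 : (p * p + 1) * d = 1 := by rw [← hu0, hd]; simp
  have hds : star d = d := by
    have h1 : (p * p + 1) * star d = 1 := by
      have := congrArg star hd1
      simpa [hp] using this
    calc star d = d * (p * p + 1) * star d := by rw [hd1, one_mul]
      _ = d := by rw [mul_assoc, h1, mul_one]
  have hcom : p * d = d * p := by
    calc p * d = d * (p * p + 1) * (p * d) := by rw [hd1, one_mul]
      _ = d * p * ((p * p + 1) * d) := by noncomm_ring
      _ = d * p := by rw [hd2, mul_one]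
  have hdpp : d * p * p = 1 - d := by
    rw [mul_add, mul_one, ← mul_assoc] at hd1
    exact eq_sub_of_add_eq hd1
  set q : A := d * p with hq
  have hqs : star q = q := by rw [hq, star_mul, hp, hds, hcom]
  have hqp : q * p = 1 - d := hdpp
  have hpq : p * q = 1 - d := by rw [hq, ← mul_assoc, hcom, hdpp]
  have hdq : d * q = q * d := by rw [hq, mul_assoc, hcom]
  have hqq : q * q = d - d * d := by
    calc q * q = d * (p * q) := by rw [hq]; noncomm_ring
      _ = _ := by rw [hpq]; noncomm_ring
  have key := aux_gns φ hφ q hqs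
    (by
      intro x
      -- 1 - q² = (1 - d/2)²+ (3/4) d² ... written as a sum of squares
      have e : star x * x = star (q * x) * (q * x) + (star (x - (1 / 2 : ℂ) • (d * x)) * (x - (1 / 2 : ℂ) • (d * x)) + (3 / 4 : ℂ) • (star (d * x) * (d * x))) := by
        simp only [star_mul, star_sub, star_smul, hqs, hds]
        have e1 : star x * q * (q * x) = star x * (d * x) - star x * (d * (d * x)) := by
          calc star x * q * (q * x) = star x * (q * q) * x := by noncomm_ring
            _ = _ := by rw [hqq]; noncomm_ring
        rw [e1]
        simp only [sub_mul, mul_sub, smul_mul_assoc, mul_smul_comm, mul_assoc]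
        simp only [star_div₀, star_one, star_ofNat]
        module
      have h1 := (Complex.nonneg_iff.1 (hφ (x - (1 / 2 : ℂ) • (d * x)))).1
      have h2 := (Complex.nonneg_iff.1 (hφ (d * x))).1
      rw [e, map_add, map_add, map_smul]
      have : ((3 / 4 : ℂ) • φ (star (d * x) * (d * x))).re = 3 / 4 * (φ (star (d * x) * (d * x))).re := by
        have : (3 / 4 : ℂ) = ((3 / 4 : ℝ) : ℂ) := by norm_num
        rw [this, smul_eq_mul, Complex.re_ofReal_mul]
      simp only [Complex.add_re, this]
      linarith)
    (by
      intro l hl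
      obtain ⟨v, hv⟩ := hu (-1 / l) (by rw [div_nonneg_iff]; right; constructor <;> linarith)
      -- (q - l) = -l d (p² + c p + 1)
      have hlne : (l : ℂ) ≠ 0 := by exact_mod_cast hl.ne
      have e : q - algebraMap ℂ A l = (-(l : ℂ)) • (d * v) := by
        rw [hv]
        have : d * (p * p + algebraMap ℂ A ((-1 / l : ℝ) : ℂ) * p + 1)
            = 1 + ((-1 / l : ℝ) : ℂ) • q := by
          rw [mul_add, mul_add, ← mul_assoc, hdpp, Algebra.algebraMap_eq_smul_one,
            smul_mul_assoc, one_mul, mul_smul_comm, ← hq]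
          noncomm_ring
        rw [this, smul_add, smul_smul]
        push_cast
        rw [show -(l : ℂ) * (-1 / l) = 1 by field_simp, Algebra.algebraMap_eq_smul_one]
        module
      refine ⟨(-(l : ℂ))⁻¹ • (↑v⁻¹ * (p * p + 1)), ?_⟩
      rw [e, smul_mul_smul_comm, mul_inv_cancel₀ (by simpa using hlne), one_smul]
      rw [mul_assoc, ← mul_assoc (v : A), Units.mul_inv, one_mul, hd1])
  have k1 := key 1
  have k2 := key p
  simp only [star_one, mul_one, one_mul, hp] at k1 k2
  have : p = q + p * (q * p) := by
    rw [hqp, mul_sub, mul_one, hcom]; abel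
  rw [this, map_add, Complex.add_re]
  linarith
end gns

lemma aux_opnorm {E : Type*} [NormedAddCommGroup E] [InnerProductSpace ℂ E]
    (T : E →L[ℂ] E) (K : ℝ) (hK : 0 ≤ K) (h : ∀ v, ‖⟪T v, v⟫_ℂ‖ ≤ K * ‖v‖ ^ 2) :
    ‖T‖ ≤ 2 * K := by
  have pol : ∀ x y : E, ‖⟪T y, x⟫_ℂ‖ ≤ K * (‖x‖ ^ 2 + ‖y‖ ^ 2) := by
    intro x y
    have e := inner_map_polarization (T : E →ₗ[ℂ] E) x y
    simp only [ContinuousLinearMap.coe_coe] at e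
    rw [e, norm_div]
    have p1 := parallelogram_law_with_norm ℂ x y
    have p2 := parallelogram_law_with_norm ℂ x (Complex.I • y)
    have hI : ‖Complex.I • y‖ = ‖y‖ := by rw [norm_smul]; simp
    rw [hI] at p2
    have n4 : ‖(4 : ℂ)‖ = 4 := by norm_num
    rw [n4, div_le_iff₀ (by norm_num)]
    have h1 := h (x + y)
    have h2 := h (x - y)
    have h3 := h (x + Complex.I • y)
    have h4 := h (x - Complex.I • y)
    refine (norm_sub_le _ _).trans ?_
    refine (add_le_add ((norm_add_le _ _).trans (add_le_add (norm_sub_le _ _) le_rfl)) le_rfl).trans ?_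
    simp only [norm_mul, Complex.norm_I, one_mul]
    nlinarith
  refine T.opNorm_le_bound (by positivity) fun y => ?_
  by_cases hy : T y = 0
  · rw [hy, norm_zero]; positivity
  have hy0 : y ≠ 0 := by rintro rfl; simp at hy
  have n1 : 0 < ‖T y‖ := norm_pos_iff.2 hy
  have n2 : 0 < ‖y‖ := norm_pos_iff.2 hy0
  have := pol (((‖y‖ / ‖T y‖ : ℝ) : ℂ) • T y) y
  rw [inner_smul_right, inner_self_eq_norm_sq_to_K, norm_mul, norm_smul, norm_pow] at this
  simp only [Complex.norm_real, Real.norm_eq_abs, Complex.coe_algebraMap, RCLike.norm_ofReal] at this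
  rw [abs_of_pos (div_pos n2 n1), abs_of_pos n1, div_mul_cancel₀ _ n1.ne'] at this
  have e : ‖y‖ / ‖T y‖ * ‖T y‖ ^ 2 = ‖y‖ * ‖T y‖ := by field_simp
  rw [e] at this
  nlinarith

section cstar
variable {B : Type*} [NormedRing B] [StarRing B] [CStarRing B] [NormedAlgebra ℂ B]
    [StarModule ℂ B] [CompleteSpace B]

lemma aux_unit_lin (a : B) (ha : IsSelfAdjoint a) (M : ℝ) (hM : ‖a‖ < M) (z : ℂ)
    (hz : ¬ (z.im = 0 ∧ 0 < z.re)) :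
    IsUnit (algebraMap ℂ B M - a - algebraMap ℂ B z) := by
  let _ : CStarAlgebra B := {}
  rw [sub_right_comm, ← map_sub]
  by_contra hcon
  have hmem : (M - z : ℂ) ∈ spectrum ℂ a := hcon
  have him := ha.im_eq_zero_of_mem_spectrum hmem
  have hn := spectrum.norm_le_norm_mul_of_mem hmem
  have : Nontrivial B := by
    by_contra hB
    rw [not_nontrivial_iff_subsingleton] at hB
    exact hcon (isUnit_of_subsingleton _)
  rw [CStarRing.norm_one, mul_one] at hn
  have hre := (Complex.re_le_norm _).trans hn
  simp at him hre
  apply hz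
  exact ⟨by simpa using him, by linarith⟩

lemma aux_unit_quad (a : B) (ha : IsSelfAdjoint a) (M : ℝ) (hM : ‖a‖ < M) (c : ℝ) (hc : 0 ≤ c)
    (p : B) (hp : p = algebraMap ℂ B M - a) :
    IsUnit (p * p + algebraMap ℂ B c * p + 1) := by
  have root : ∀ z : ℂ, z * z + c * z + 1 = 0 → IsUnit (p - algebraMap ℂ B z) := by
    intro z hz
    rw [hp]
    refine aux_unit_lin a ha M hM z ?_
    rintro ⟨h1, h2⟩
    have := congrArg Complex.re hz
    simp [h1] at this
    nlinarith [mul_nonneg hc h2.le]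
  obtain ⟨z, hz⟩ : ∃ z : ℂ, z * z + c * z + 1 = 0 := by
    obtain ⟨s, hs⟩ := IsAlgClosed.exists_pow_nat_eq ((c : ℂ) ^ 2 - 4) (n := 2) (by norm_num)
    refine ⟨(-c + s) / 2, ?_⟩
    linear_combination hs / 4
  have h1 := root z hz
  have h2 := root (-c - z) (by linear_combination hz)
  have e : p * p + algebraMap ℂ B c * p + 1
      = (p - algebraMap ℂ B z) * (p - algebraMap ℂ B (-c - z)) := by
    have : (1 : ℂ) = z * (-c - z) := by linear_combination hz
    have h1' : (1 : B) = algebraMap ℂ B z * algebraMap ℂ B (-c - z) := by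
      rw [← map_mul, ← this, map_one]
    nth_rewrite 1 [h1']
    rw [mul_sub, sub_mul, sub_mul, ← Algebra.commutes (-c - z : ℂ) p]
    simp only [map_sub, map_neg, sub_mul, neg_mul, mul_sub, mul_neg]
    abel
  rw [e]
  exact h1.mul h2

variable (A : StarSubalgebra ℂ B)

lemma aux_isUnit (hhfc : ∀ a : B, a ∈ A → ∀ b : B, b * a = 1 → a * b = 1 → b ∈ A)
    (a : A) (h : IsUnit (a : B)) : IsUnit a := by
  obtain ⟨u, hu⟩ := h
  have h1 : (↑u⁻¹ : B) * a = 1 := by rw [← hu]; simp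
  have h2 : (a : B) * ↑u⁻¹ = 1 := by rw [← hu]; simp
  exact ⟨⟨a, ⟨_, hhfc a a.2 _ h1 h2⟩, Subtype.ext h2, Subtype.ext h1⟩, rfl⟩

lemma aux_sa_bound (hhfc : ∀ a : B, a ∈ A → ∀ b : B, b * a = 1 → a * b = 1 → b ∈ A)
    (φ : A →ₗ[ℂ] ℂ) (hφ : ∀ a, 0 ≤ φ (star a * a)) (a : A) (ha : star a = a) :
    (φ a).re ≤ ‖(a : B)‖ * (φ 1).re := by
  have key : ∀ M : ℝ, ‖(a : B)‖ < M → (φ a).re ≤ M * (φ 1).re := by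
    intro M hM
    have hsa : IsSelfAdjoint (a : B) := by
      have := congrArg (Subtype.val) ha
      exact this
    have := aux_pos φ hφ (algebraMap ℂ A M - a) (by
        rw [star_sub, ha, ← algebraMap_star_comm]; simp)
      (fun c hc => aux_isUnit A hhfc _
        (aux_unit_quad (a : B) hsa M hM c hc _ rfl))
    rw [map_sub, Algebra.algebraMap_eq_smul_one, map_smul, Complex.sub_re, smul_eq_mul,
      Complex.re_ofReal_mul] at this
    linarith
  have h1 : 0 ≤ (φ 1).re := by
    have := (Complex.nonneg_iff.1 (hφ 1)).1
    simpa using this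
  refine le_of_forall_pos_le_add fun ε hε => ?_
  have := key (‖(a : B)‖ + ε / ((φ 1).re + 1)) (by linarith [show 0 < ε / ((φ 1).re + 1) by positivity])
  have e : ε / ((φ 1).re + 1) * (φ 1).re ≤ ε := by
    rw [div_mul_eq_mul_div, div_le_iff₀ (by positivity)]
    nlinarith
  nlinarith

lemma aux_bound (hhfc : ∀ a : B, a ∈ A → ∀ b : B, b * a = 1 → a * b = 1 → b ∈ A)
    (φ : A →ₗ[ℂ] ℂ) (hφ : ∀ a, 0 ≤ φ (star a * a)) (a : A) :
    ‖φ a‖ ≤ 2 * ‖(a : B)‖ * (φ 1).re := by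
  have h1 : 0 ≤ (φ 1).re := by
    have := (Complex.nonneg_iff.1 (hφ 1)).1
    simpa using this
  have re1 : ∀ a : A, (φ a).re ≤ ‖(a : B)‖ * (φ 1).re := by
    intro a
    have h2 := aux_sa_bound A hhfc φ hφ (a + star a) (by rw [star_add, star_star, add_comm])
    rw [map_add, aux_herm φ hφ] at h2
    have h3 : ‖((a + star a : A) : B)‖ ≤ 2 * ‖(a : B)‖ := by
      have : ((a + star a : A) : B) = (a : B) + star (a : B) := rfl
      rw [this]
      refine (norm_add_le _ _).trans ?_
      rw [norm_star]; linarith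
    have h4 := mul_le_mul_of_nonneg_right h3 h1
    have h5 := h2.trans h4
    simp at h5
    linarith
  have re2 : ∀ a : A, |(φ a).re| ≤ ‖(a : B)‖ * (φ 1).re := by
    intro a
    rw [abs_le']
    refine ⟨re1 a, ?_⟩
    have := re1 (-a)
    simpa using this
  have hre := re2 a
  have him := re2 (Complex.I • a)
  have e : ‖((Complex.I • a : A) : B)‖ = ‖(a : B)‖ := by
    have : ((Complex.I • a : A) : B) = Complex.I • (a : B) := rfl
    rw [this, norm_smul]; simp
  rw [e, map_smul] at him
  simp at him
  have := Complex.norm_le_abs_re_add_abs_im (φ a)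
  linarith

lemma aux_theta_bound (hhfc : ∀ a : B, a ∈ A → ∀ b : B, b * a = 1 → a * b = 1 → b ∈ A)
    {E : Type*} [NormedAddCommGroup E] [InnerProductSpace ℂ E]
    (Θ : A →ₗ[ℂ] (E →L[ℂ] E)) (hpos : ∀ a : A, (Θ (star a * a)).IsPositive) :
    ∃ C : ℝ, ∀ a : A, ‖Θ a‖ ≤ C * ‖(a : B)‖ := by
  refine ⟨4 * ‖Θ 1‖, fun a => ?_⟩
  have := aux_opnorm (Θ a) (2 * ‖(a : B)‖ * ‖Θ 1‖) (by positivity) (fun v => ?_)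
  · linarith
  let φ : A →ₗ[ℂ] ℂ :=
    { toFun := fun b => ⟪v, Θ b v⟫_ℂ
      map_add' := fun b c => by simp [inner_add_right]
      map_smul' := fun b c => by simp [inner_smul_right] }
  have hφ : ∀ b, 0 ≤ φ (star b * b) := fun b => (hpos b).inner_nonneg_right v
  have h := aux_bound A hhfc φ hφ a
  have e1 : ‖⟪Θ a v, v⟫_ℂ‖ = ‖φ a‖ := norm_inner_symm _ _
  have e2 : (φ 1).re ≤ ‖Θ 1‖ * ‖v‖ ^ 2 := by
    calc (φ 1).re ≤ ‖⟪v, Θ 1 v⟫_ℂ‖ := Complex.re_le_norm _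
      _ ≤ ‖v‖ * ‖Θ 1 v‖ := norm_inner_le_norm _ _
      _ ≤ ‖v‖ * (‖Θ 1‖ * ‖v‖) := by gcongr; exact (Θ 1).le_opNorm v
      _ = _ := by ring
  rw [e1]
  calc ‖φ a‖ ≤ _ := h
    _ ≤ 2 * ‖(a : B)‖ * (‖Θ 1‖ * ‖v‖ ^ 2) := by gcongr
    _ = _ := by ring

end cstar

end aux

/-- Let `B` be a unital C*-algebra and `A ⊆ B` a dense unital *-subalgebra
which is closed under the holomorphic functional calculus of `B` (rendered here by the standard
equivalent spectral-permanence property: `A` is closed under taking inverses of elements that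
are invertible in `B`).  Let `Θ : A → M_k(ℂ)` be a positive linear map (`Θ(a* a)` positive
semidefinite for every `a ∈ A`, with `M_k(ℂ)` realized as operators on `ℂ^k`).  Then `Θ`
extends uniquely to a positive linear map on `B`. -/
theorem positive_map_extends_uniquely_from_dense_hfc_subalgebra
    (B : Type*) [NormedRing B] [StarRing B] [CStarRing B] [NormedAlgebra ℂ B]
    [StarModule ℂ B] [CompleteSpace B]
    (A : StarSubalgebra ℂ B)
    (hdense : Dense (A : Set B))
    (hhfc : ∀ a : B, a ∈ A → ∀ b : B, b * a = 1 → a * b = 1 → b ∈ A)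
    (k : ℕ)
    (Θ : A →ₗ[ℂ] (EuclideanSpace ℂ (Fin k) →L[ℂ] EuclideanSpace ℂ (Fin k)))
    (hpos : ∀ a : A, (Θ (star a * a)).IsPositive) :
    ∃! Θ' : B →ₗ[ℂ] (EuclideanSpace ℂ (Fin k) →L[ℂ] EuclideanSpace ℂ (Fin k)),
      (∀ b : B, (Θ' (star b * b)).IsPositive) ∧ (∀ a : A, Θ' (a : B) = Θ a) := by
  have hd : DenseRange (A.subtype.toAlgHom.toLinearMap : A →ₗ[ℂ] B) := by
    have : Set.range (A.subtype.toAlgHom.toLinearMap : A →ₗ[ℂ] B) = (A : Set B) := by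
      ext x; simp
    rw [DenseRange, this]; exact hdense
  obtain ⟨C, hC⟩ := aux_theta_bound A hhfc Θ hpos
  let F := Θ.extendOfNorm (A.subtype.toAlgHom.toLinearMap : A →ₗ[ℂ] B)
  have hF : ∀ a : A, F (a : B) = Θ a := fun a => LinearMap.extendOfNorm_eq hd ⟨C, hC⟩ a
  refine ⟨F.toLinearMap, ⟨fun b => ?_, hF⟩, ?_⟩
  · show (F (star b * b)).IsPositive
    rw [← ContinuousLinearMap.nonneg_iff_isPositive]
    refine hdense.induction (P := fun b => 0 ≤ F (star b * b)) ?_ ?_ b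
    · intro x hx
      have := hpos ⟨x, hx⟩
      rw [← hF] at this
      rw [ContinuousLinearMap.nonneg_iff_isPositive]
      exact this
    · have : Continuous fun b : B => F (star b * b) := by fun_prop
      exact isClosed_Ici.preimage this
  · rintro G ⟨hG, hGA⟩
    obtain ⟨C', hC'⟩ := aux_theta_bound (⊤ : StarSubalgebra ℂ B) (fun _ _ _ _ _ => trivial)
      (G ∘ₗ ((⊤ : StarSubalgebra ℂ B).subtype.toAlgHom.toLinearMap)) (fun a => hG a)
    have hGc : Continuous G :=
      AddMonoidHomClass.continuous_of_bound G C' (fun x => hC' ⟨x, trivial⟩)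
    apply LinearMap.ext
    intro x
    have : (G : B → _) = F := by
      refine Continuous.ext_on hdense hGc F.continuous ?_
      intro x hx
      rw [hF ⟨x, hx⟩]
      exact hGA ⟨x, hx⟩
    exact congrFun this x
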